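/- Let (x*,λ*) be a saddle point of L, assume the scaling condition holds, and let (x,λ) be a global solution of the primal-dual dynamical system. Then there exists a constant C ≥ 0 such that L(x(t),λ*) − L(x*,λ(t)) ≤ C/β(t) for all t ≥ t₀; in particular, if lim_{t→∞} β(t) = +∞, then L(x(t),λ*) − L(x*,λ(t)) = O(1/β(t)) as t → ∞. -/

import Mathlib

open scoped RealInnerProductSpace
open MeasureTheory Set

noncomputable def Lagr {n m : ℕ} (f : EuclideanSpace ℝ (Fin n) → ℝ)
    (A : EuclideanSpace ℝ (Fin n) →L[ℝ] EuclideanSpace ℝ (Fin m))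
    (b : EuclideanSpace ℝ (Fin m))
    (x : EuclideanSpace ℝ (Fin n)) (lam : EuclideanSpace ℝ (Fin m)) : ℝ :=
  f x + ⟪lam, A x - b⟫

noncomputable def AugLagr {n m : ℕ} (f : EuclideanSpace ℝ (Fin n) → ℝ)
    (A : EuclideanSpace ℝ (Fin n) →L[ℝ] EuclideanSpace ℝ (Fin m))
    (b : EuclideanSpace ℝ (Fin m)) (σ : ℝ)
    (x : EuclideanSpace ℝ (Fin n)) (lam : EuclideanSpace ℝ (Fin m)) : ℝ :=
  Lagr f A b x lam + σ / 2 * ‖A x - b‖ ^ 2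

def IsSaddlePoint {n m : ℕ} (f : EuclideanSpace ℝ (Fin n) → ℝ)
    (A : EuclideanSpace ℝ (Fin n) →L[ℝ] EuclideanSpace ℝ (Fin m))
    (b : EuclideanSpace ℝ (Fin m))
    (xs : EuclideanSpace ℝ (Fin n)) (ls : EuclideanSpace ℝ (Fin m)) : Prop :=
  ∀ x lam, Lagr f A b xs lam ≤ Lagr f A b xs ls ∧ Lagr f A b xs ls ≤ Lagr f A b x ls

/-- First-order (gradient) inequality for a differentiable convex function on a Hilbert space. -/
theorem ConvexOn.inner_gradient_le_sub {E : Type*} [NormedAddCommGroup E]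
    [InnerProductSpace ℝ E] [CompleteSpace E] {f : E → ℝ} (hf : ConvexOn ℝ Set.univ f) {x : E}
    (hx : DifferentiableAt ℝ f x) (y : E) : ⟪gradient f x, y - x⟫ ≤ f y - f x := by
  have hline : HasDerivAt (AffineMap.lineMap (k := ℝ) x y) (y - x) 0 :=
    AffineMap.hasDerivAt_lineMap
  have hgrad : HasFDerivAt f (InnerProductSpace.toDual ℝ E (gradient f x))
      (AffineMap.lineMap (k := ℝ) x y 0) := by
    simpa using hx.hasGradientAt.hasFDerivAt
  have hderiv := hgrad.comp_hasDerivAt (0 : ℝ) hline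
  have hconv := hf.comp_affineMap (AffineMap.lineMap (k := ℝ) x y)
  have hslope := hconv.le_slope_of_hasDerivAt (Set.mem_univ 0) (Set.mem_univ 1) one_pos hderiv
  simpa [slope_def_field] using hslope

theorem IsSaddlePoint.feasible {n m : ℕ} {f : EuclideanSpace ℝ (Fin n) → ℝ}
    {A : EuclideanSpace ℝ (Fin n) →L[ℝ] EuclideanSpace ℝ (Fin m)}
    {b : EuclideanSpace ℝ (Fin m)} {xs : EuclideanSpace ℝ (Fin n)}
    {ls : EuclideanSpace ℝ (Fin m)} (h : IsSaddlePoint f A b xs ls) : A xs = b := by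
  have h1 := (h xs (ls + (A xs - b))).1
  simp only [Lagr, inner_add_left] at h1
  have h2 : ⟪A xs - b, A xs - b⟫ ≤ 0 := by linarith
  rw [real_inner_self_nonpos] at h2
  exact sub_eq_zero.mp h2

/-- The Lyapunov function of the primal-dual dynamics, evaluated at primal position `x`, velocity
`v`, multiplier `lam` and time-scaling value `β`. -/
noncomputable def primalDualEnergy {n m : ℕ} (f : EuclideanSpace ℝ (Fin n) → ℝ)
    (A : EuclideanSpace ℝ (Fin n) →L[ℝ] EuclideanSpace ℝ (Fin m))
    (b : EuclideanSpace ℝ (Fin m)) (γ δ σ : ℝ) (xs : EuclideanSpace ℝ (Fin n))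
    (ls : EuclideanSpace ℝ (Fin m)) (β : ℝ) (x v : EuclideanSpace ℝ (Fin n))
    (lam : EuclideanSpace ℝ (Fin m)) : ℝ :=
  δ ^ 2 * (β * (AugLagr f A b σ x ls - f xs)) + 1 / 2 * ‖x - xs + δ • v‖ ^ 2
    + δ / 2 * ‖lam - ls‖ ^ 2 + (γ * δ - 1) / 2 * ‖x - xs‖ ^ 2

theorem hasDerivWithinAt_augLagr {n m : ℕ} {f : EuclideanSpace ℝ (Fin n) → ℝ}
    (hf : Differentiable ℝ f) (A : EuclideanSpace ℝ (Fin n) →L[ℝ] EuclideanSpace ℝ (Fin m))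
    (b ls : EuclideanSpace ℝ (Fin m)) (σ : ℝ) {x : ℝ → EuclideanSpace ℝ (Fin n)}
    {v : EuclideanSpace ℝ (Fin n)} {s : Set ℝ} {t : ℝ} (hx : HasDerivWithinAt x v s t) :
    HasDerivWithinAt (fun r ↦ AugLagr f A b σ (x r) ls)
      (⟪gradient f (x t), v⟫ + ⟪ls, A v⟫ + σ * ⟪A (x t) - b, A v⟫) s t := by
  have hfx := ((hf (x t)).hasGradientAt.hasFDerivAt).comp_hasDerivWithinAt t hx
  have hA : HasDerivWithinAt (fun r ↦ A (x r) - b) (A v) s t :=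
    (A.hasFDerivAt.comp_hasDerivWithinAt t hx).sub_const b
  have hls := (hasDerivWithinAt_const t s ls).inner ℝ hA
  refine ((hfx.add hls).add (hA.norm_sq.const_mul (σ / 2))).congr_deriv ?_
  simp
  ring

/-- Along the dynamics the derivative of the energy is nonpositive. -/
theorem primalDualEnergy_deriv_nonpos {n m : ℕ} {f : EuclideanSpace ℝ (Fin n) → ℝ}
    (hf_conv : ConvexOn ℝ Set.univ f) (hf : Differentiable ℝ f)
    {A : EuclideanSpace ℝ (Fin n) →L[ℝ] EuclideanSpace ℝ (Fin m)}
    {b : EuclideanSpace ℝ (Fin m)} {γ δ σ β β' : ℝ} (hδ : 0 < δ) (hσ : 0 < σ) (hβ : 0 < β)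
    (hβ' : β' ≤ β / δ) (hγ : 1 / δ < γ) {xs : EuclideanSpace ℝ (Fin n)}
    {ls : EuclideanSpace ℝ (Fin m)} (hsaddle : IsSaddlePoint f A b xs ls)
    {x v a : EuclideanSpace ℝ (Fin n)} {lam lam' : EuclideanSpace ℝ (Fin m)}
    (hode1 : a + γ • v =
      -β • (gradient f x + A.adjoint lam + σ • A.adjoint (A x - b)))
    (hode2 : lam' = β • (A (x + δ • v) - b)) :
    δ ^ 2 * (β' * (AugLagr f A b σ x ls - f xs)
        + β * (⟪gradient f x, v⟫ + ⟪ls, A v⟫ + σ * ⟪A x - b, A v⟫))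
      + 1 / 2 * (2 * ⟪x - xs + δ • v, v + δ • a⟫) + δ / 2 * (2 * ⟪lam - ls, lam'⟫)
      + (γ * δ - 1) / 2 * (2 * ⟪x - xs, v⟫) ≤ 0 := by
  have hfeas := hsaddle.feasible
  have hgap := (hsaddle x ls).2
  have hgrad := hf_conv.inner_gradient_le_sub (hf x) xs
  obtain ⟨u, rfl⟩ : ∃ u, x = xs + u := ⟨x - xs, by abel⟩
  have ha : a = -β • (gradient f (xs + u) + A.adjoint lam + σ • A.adjoint (A u)) - γ • v := by
    rw [eq_sub_iff_add_eq, hode1, map_add, hfeas, add_sub_cancel_left]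
  subst ha hode2 hfeas
  simp only [Lagr, AugLagr, map_add, map_smul, add_sub_cancel_left, sub_self, inner_zero_right,
    add_zero, sub_add_cancel_left, inner_neg_right, add_assoc] at hgap hgrad ⊢
  set g := gradient f (xs + u)
  set F := f (xs + u) - f xs + ⟪ls, A u⟫ with hF
  have hF0 : 0 ≤ F := by linarith
  have hcoef : δ * β' ≤ β := by
    rw [le_div_iff₀ hδ] at hβ'; linarith
  have hc : 0 < γ * δ - 1 := by
    rw [div_lt_iff₀ hδ] at hγ; linarith
  have h1 : δ * (δ * β') * (F + σ / 2 * ‖A u‖ ^ 2) ≤ δ * β * (F + σ / 2 * ‖A u‖ ^ 2) := by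
    gcongr
  have h2 : δ * β * F ≤ δ * β * (⟪g, u⟫ + ⟪ls, A u⟫) := by
    gcongr; linarith
  have h3 : 0 ≤ (γ * δ - 1) * δ * ‖v‖ ^ 2 := by positivity
  have h4 : 0 ≤ δ * β * (σ / 2 * ‖A u‖ ^ 2) := by positivity
  simp only [inner_add_left, inner_add_right, inner_sub_left, inner_sub_right, inner_smul_left,
    inner_smul_right, ContinuousLinearMap.adjoint_inner_right, real_inner_self_eq_norm_sq,
    RCLike.conj_to_real, smul_add, smul_sub, map_add, map_smul]
  simp only [real_inner_comm] at h2 ⊢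
  rw [hF] at h1 h2
  linarith only [h1, h2, h3, h4]

theorem lagrangian_gap_rate
    {n m : ℕ}
    (f : EuclideanSpace ℝ (Fin n) → ℝ)
    (hf_conv : ConvexOn ℝ Set.univ f)
    (hf_smooth : ContDiff ℝ 1 f)
    (A : EuclideanSpace ℝ (Fin n) →L[ℝ] EuclideanSpace ℝ (Fin m))
    (b : EuclideanSpace ℝ (Fin m))
    (t₀ γ δ σ : ℝ) (ht₀ : 0 ≤ t₀) (hγ : 0 < γ) (hδ : 0 < δ) (hσ : 0 < σ)
    (β β' : ℝ → ℝ)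
    (hβpos : ∀ t ∈ Ici t₀, 0 < β t)
    (hβderiv : ∀ t ∈ Ici t₀, HasDerivWithinAt β (β' t) (Ici t₀) t)
    (hβ'cont : ContinuousOn β' (Ici t₀))
    (xs : EuclideanSpace ℝ (Fin n)) (ls : EuclideanSpace ℝ (Fin m))
    (hsaddle : IsSaddlePoint f A b xs ls)
    (hscale : ∀ t ∈ Ici t₀, β' t ≤ β t / δ) (hscale' : 1 / δ < γ)
    (x x' x'' : ℝ → EuclideanSpace ℝ (Fin n))
    (lam lam' : ℝ → EuclideanSpace ℝ (Fin m))
    (hx : ∀ t ∈ Ici t₀, HasDerivWithinAt x (x' t) (Ici t₀) t)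
    (hx' : ∀ t ∈ Ici t₀, HasDerivWithinAt x' (x'' t) (Ici t₀) t)
    (hx''cont : ContinuousOn x'' (Ici t₀))
    (hlam : ∀ t ∈ Ici t₀, HasDerivWithinAt lam (lam' t) (Ici t₀) t)
    (hlam'cont : ContinuousOn lam' (Ici t₀))
    (hode1 : ∀ t ∈ Ici t₀, x'' t + γ • x' t =
      -(β t) • (gradient f (x t) + A.adjoint (lam t) + σ • A.adjoint (A (x t) - b)))
    (hode2 : ∀ t ∈ Ici t₀, lam' t = β t • (A (x t + δ • x' t) - b))
    :
    ∃ C : ℝ, 0 ≤ C ∧ ∀ t ∈ Ici t₀,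
      Lagr f A b (x t) ls - Lagr f A b xs (lam t) ≤ C / β t := by
  set s := Ici t₀
  have hf : Differentiable ℝ f := hf_smooth.differentiable (by simp)
  have hfeas := hsaddle.feasible
  let E : ℝ → ℝ := fun t ↦ primalDualEnergy f A b γ δ σ xs ls (β t) (x t) (x' t) (lam t)
  have hE : ∀ t ∈ s, HasDerivWithinAt E
      (δ ^ 2 * (β' t * (AugLagr f A b σ (x t) ls - f xs) + β t *
          (⟪gradient f (x t), x' t⟫ + ⟪ls, A (x' t)⟫ + σ * ⟪A (x t) - b, A (x' t)⟫))
        + 1 / 2 * (2 * ⟪x t - xs + δ • x' t, x' t + δ • x'' t⟫)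
        + δ / 2 * (2 * ⟪lam t - ls, lam' t⟫)
        + (γ * δ - 1) / 2 * (2 * ⟪x t - xs, x' t⟫)) s t := fun t ht ↦
    have hu := (hx t ht).sub_const xs
    ((((hβderiv t ht).mul ((hasDerivWithinAt_augLagr hf A b ls σ (hx t ht)).sub_const
      (f xs))).const_mul (δ ^ 2)).add
      ((hu.add ((hx' t ht).const_smul δ)).norm_sq.const_mul (1 / 2))).add
      (((hlam t ht).sub_const ls).norm_sq.const_mul (δ / 2)) |>.add
      (hu.norm_sq.const_mul ((γ * δ - 1) / 2))
  have hanti : AntitoneOn E s :=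
    antitoneOn_of_hasDerivWithinAt_nonpos (convex_Ici t₀)
      (fun t ht ↦ (hE t ht).continuousWithinAt)
      (fun t ht ↦ (hE t (interior_subset ht)).mono interior_subset)
      fun t ht ↦ by
        have ht := interior_subset ht
        exact primalDualEnergy_deriv_nonpos hf_conv hf hδ hσ (hβpos t ht) (hscale t ht) hscale'
          hsaddle (hode1 t ht) (hode2 t ht)
  have hc : 0 < γ * δ - 1 := by
    rw [div_lt_iff₀ hδ] at hscale'; linarith
  have hbound : ∀ t ∈ s,
      δ ^ 2 * (β t * (Lagr f A b (x t) ls - Lagr f A b xs (lam t))) ≤ E t := by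
    intro t ht
    have hβt := hβpos t ht
    have hσt : 0 ≤ δ ^ 2 * (β t * (σ / 2 * ‖A (x t) - b‖ ^ 2)) := by positivity
    have hrest : 0 ≤ 1 / 2 * ‖x t - xs + δ • x' t‖ ^ 2 + δ / 2 * ‖lam t - ls‖ ^ 2
        + (γ * δ - 1) / 2 * ‖x t - xs‖ ^ 2 := by positivity
    have hxs : Lagr f A b xs (lam t) = f xs := by simp [Lagr, hfeas]
    rw [hxs]
    simp only [E, primalDualEnergy, AugLagr]
    linarith
  have hgap : ∀ t, 0 ≤ Lagr f A b (x t) ls - Lagr f A b xs (lam t) := fun t ↦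
    sub_nonneg.mpr ((hsaddle xs (lam t)).1.trans (hsaddle (x t) ls).2)
  have ht₀s : t₀ ∈ s := self_mem_Ici
  refine ⟨E t₀ / δ ^ 2, div_nonneg (le_trans ?_ (hbound t₀ ht₀s)) (sq_nonneg δ), fun t ht ↦ ?_⟩
  · exact mul_nonneg (sq_nonneg δ) (mul_nonneg (hβpos t₀ ht₀s).le (hgap t₀))
  · rw [le_div_iff₀ (hβpos t ht), le_div_iff₀ (by positivity)]
    linarith [hbound t ht, hanti ht₀s ht ht]
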